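/- arXiv:1510.02864 — 2 statements merged into one kernel-verified Lean document; each statement's English description precedes it below -/
import Mathlib

section
/- Assume ρ ∈ (0,1) and σx < σy. Then for every a = (x1, y1) ∈ ℝ² with x1² + y1² < 2c², one has K(a, b*) > 0. -/
open MeasureTheory ProbabilityTheory Real

/-- The bivariate normal measure on ℝ × ℝ with mean (0,0), standard deviations
`sx, sy` and correlation `ρ`, realized as the pushforward of two independent
standard gaussians. -/
noncomputable def binormal (sx sy ρ : ℝ) : Measure (ℝ × ℝ) :=
  Measure.map (fun z : ℝ × ℝ => (sx * z.1, sy * (ρ * z.1 + Real.sqrt (1 - ρ ^ 2) * z.2)))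
    ((gaussianReal 0 1).prod (gaussianReal 0 1))

/-- The set of points strictly closer (in Euclidean distance) to `a` than to `b`. -/
def closerTo (a b : ℝ × ℝ) : Set (ℝ × ℝ) :=
  {p | (p.1 - a.1) ^ 2 + (p.2 - a.2) ^ 2 < (p.1 - b.1) ^ 2 + (p.2 - b.2) ^ 2}

/-- The expected payoff (from Player I to Player II) when Player I offers `a`
and Player II offers `b`. -/
noncomputable def K (sx sy ρ : ℝ) (a b : ℝ × ℝ) : ℝ :=
  if a = b then a.1 + a.2
  else (a.1 + a.2) * ((binormal sx sy ρ) (closerTo a b)).toReal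
    + (b.1 + b.2) * ((binormal sx sy ρ) (closerTo b a)).toReal

/-- The common optimal offer magnitude. -/
noncomputable def cstar (sx sy ρ : ℝ) : ℝ :=
  Real.sqrt (2 * Real.pi * (sx ^ 2 + 2 * ρ * sx * sy + sy ^ 2)) / 4

/-- The law of a linear form under the product of two standard gaussians. -/
lemma map_linear_gaussianReal_prod (A B : ℝ) :
    Measure.map (fun z : ℝ × ℝ => A * z.1 + B * z.2)
      ((gaussianReal 0 1).prod (gaussianReal 0 1))
      = gaussianReal 0 (A ^ 2 + B ^ 2).toNNReal := by
  have hA := gaussianReal_map_const_mul (μ := 0) (v := 1) A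
  have hB := gaussianReal_map_const_mul (μ := 0) (v := 1) B
  have hconv := gaussianReal_conv_gaussianReal (m₁ := A * 0) (m₂ := B * 0)
    (v₁ := ⟨A ^ 2, sq_nonneg A⟩ * 1) (v₂ := ⟨B ^ 2, sq_nonneg B⟩ * 1)
  have hcomp : (fun z : ℝ × ℝ => A * z.1 + B * z.2)
      = (fun z : ℝ × ℝ => z.1 + z.2) ∘ Prod.map (fun x => A * x) (fun x => B * x) := rfl
  rw [hcomp, ← Measure.map_map (by fun_prop) (by fun_prop),
    ← Measure.map_prod_map _ _ (by fun_prop) (by fun_prop), hA, hB]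
  refine hconv.trans ?_
  congr 1
  · ring
  · ext
    rw [Real.coe_toNNReal _ (by positivity)]
    change A ^ 2 * 1 + B ^ 2 * 1 = A ^ 2 + B ^ 2
    ring

lemma gaussianReal_real_Ioi_zero {v : NNReal} (hv : v ≠ 0) :
    (gaussianReal 0 v).real (Set.Ioi 0) = 1 / 2 := by
  have := nullSingletonClass_gaussianReal (μ := 0) hv
  have hsymm : (gaussianReal 0 v).real (Set.Iio 0) = (gaussianReal 0 v).real (Set.Ioi 0) := by
    have h := gaussianReal_map_neg (μ := 0) (v := v)
    rw [neg_zero] at h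
    conv_lhs => rw [← h]
    rw [map_measureReal_apply (by fun_prop) measurableSet_Iio]
    congr 1
    ext x
    simp
  have hcompl := probReal_compl_eq_one_sub (μ := gaussianReal 0 v) (measurableSet_Ioi (a := (0 : ℝ)))
  rw [Set.compl_Ioi, ← measureReal_congr Iio_ae_eq_Iic, hsymm] at hcompl
  linarith

lemma gaussianReal_real_Ioc_zero_le {v : NNReal} (hv : v ≠ 0) {d : ℝ} (hd : 0 ≤ d) :
    (gaussianReal 0 v).real (Set.Ioc 0 d) ≤ d / √(2 * π * v) := by
  have hb : gaussianReal 0 v (Set.Ioc 0 d) ≤ ENNReal.ofReal (d / √(2 * π * v)) := by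
    rw [gaussianReal_apply 0 hv]
    calc ∫⁻ x in Set.Ioc 0 d, gaussianPDF 0 v x
        ≤ ∫⁻ _ in Set.Ioc 0 d, ENNReal.ofReal (√(2 * π * v))⁻¹ := by
          refine lintegral_mono fun x => ENNReal.ofReal_le_ofReal ?_
          rw [gaussianPDFReal]
          refine mul_le_of_le_one_right (by positivity) (Real.exp_le_one_iff.2 ?_)
          exact div_nonpos_of_nonpos_of_nonneg (by nlinarith [sq_nonneg (x - 0)]) (by positivity)
      _ = ENNReal.ofReal (d / √(2 * π * v)) := by
          rw [setLIntegral_const, Real.volume_Ioc, ← ENNReal.ofReal_mul (by positivity)]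
          congr 1
          ring
  exact ENNReal.toReal_le_of_le_ofReal (by positivity) hb

lemma half_sub_le_gaussianReal_real_Ioi {v : NNReal} (hv : v ≠ 0) {d : ℝ} (hd : 0 ≤ d) :
    1 / 2 - d / √(2 * π * v) ≤ (gaussianReal 0 v).real (Set.Ioi d) := by
  have h := measureReal_union (μ := gaussianReal 0 v) (s₁ := Set.Ioc 0 d) (s₂ := Set.Ioi d)
    (Set.Ioc_disjoint_Ioi le_rfl) measurableSet_Ioi
  rw [Set.Ioc_union_Ioi_eq_Ioi hd, gaussianReal_real_Ioi_zero hv] at h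
  linarith [gaussianReal_real_Ioc_zero_le hv hd]

instance isProbabilityMeasure_binormal (sx sy ρ : ℝ) :
    IsProbabilityMeasure (binormal sx sy ρ) :=
  Measure.isProbabilityMeasure_map (by fun_prop)

/-- The law of a linear form under the bivariate normal measure. -/
lemma map_linear_binormal {sx sy ρ : ℝ} (hρ : ρ ^ 2 ≤ 1) (α β : ℝ) :
    Measure.map (fun p : ℝ × ℝ => α * p.1 + β * p.2) (binormal sx sy ρ)
      = gaussianReal 0 (sx ^ 2 * α ^ 2 + 2 * ρ * sx * sy * α * β + sy ^ 2 * β ^ 2).toNNReal := by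
  rw [binormal, Measure.map_map (by fun_prop) (by fun_prop)]
  convert map_linear_gaussianReal_prod (α * sx + β * sy * ρ) (β * sy * √(1 - ρ ^ 2)) using 2
  · ext z
    simp only [Function.comp_apply]
    ring
  · have h : √(1 - ρ ^ 2) ^ 2 = 1 - ρ ^ 2 := Real.sq_sqrt (by linarith)
    rw [mul_pow, h]
    congr 1
    ring

lemma closerTo_eq_preimage_Ioi (a b : ℝ × ℝ) :
    closerTo b a = (fun p : ℝ × ℝ => (b.1 - a.1) * p.1 + (b.2 - a.2) * p.2) ⁻¹'
      Set.Ioi ((b.1 ^ 2 + b.2 ^ 2 - a.1 ^ 2 - a.2 ^ 2) / 2) := by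
  ext p
  simp only [closerTo, Set.mem_ofPred_eq, Set.mem_preimage, Set.mem_Ioi]
  constructor <;> intro h <;> linarith

lemma binormal_real_closerTo {sx sy ρ : ℝ} (hρ : ρ ^ 2 ≤ 1) (a b : ℝ × ℝ) :
    (binormal sx sy ρ).real (closerTo b a)
      = (gaussianReal 0 (sx ^ 2 * (b.1 - a.1) ^ 2 + 2 * ρ * sx * sy * (b.1 - a.1) * (b.2 - a.2)
          + sy ^ 2 * (b.2 - a.2) ^ 2).toNNReal).real
        (Set.Ioi ((b.1 ^ 2 + b.2 ^ 2 - a.1 ^ 2 - a.2 ^ 2) / 2)) := by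
  rw [← map_linear_binormal hρ, map_measureReal_apply (by fun_prop) measurableSet_Ioi,
    closerTo_eq_preimage_Ioi]

lemma sqrt_lower_bound {sx sy ρ c m u : ℝ} (hsx : 0 < sx) (hsy : 0 < sy)
    (hρ₀ : 0 ≤ ρ) (hρ₁ : ρ ≤ 1)
    (hcS : 8 * c ^ 2 = π * (sx ^ 2 + 2 * ρ * sx * sy + sy ^ 2)) (hu : |u| < m) :
    4 * c * (m - |u|) ≤ √(2 * π * (sx ^ 2 * (m - u) ^ 2
      + 2 * ρ * sx * sy * (m - u) * (m + u) + sy ^ 2 * (m + u) ^ 2)) := by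
  set S := sx ^ 2 + 2 * ρ * sx * sy + sy ^ 2 with hS
  set V := sx ^ 2 * (m - u) ^ 2 + 2 * ρ * sx * sy * (m - u) * (m + u) + sy ^ 2 * (m + u) ^ 2
    with hV
  have hxy : 0 ≤ ρ * sx * sy := by positivity
  have hS0 : 0 < S := by positivity
  have hcov : |sy ^ 2 - sx ^ 2| ≤ S := by
    rw [abs_le]
    constructor <;> nlinarith [sq_nonneg sx, sq_nonneg sy]
  have hprod : -(|u| * S) ≤ u * (sy ^ 2 - sx ^ 2) := by
    have h1 := neg_abs_le (u * (sy ^ 2 - sx ^ 2))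
    rw [abs_mul] at h1
    linarith [mul_le_mul_of_nonneg_left hcov (abs_nonneg u)]
  have hlin : S * (m - |u|) ≤ m * S + u * (sy ^ 2 - sx ^ 2) := by linarith
  have hsq : (S * (m - |u|)) ^ 2 ≤ V * S := by
    have h1 : (S * (m - |u|)) ^ 2 ≤ (m * S + u * (sy ^ 2 - sx ^ 2)) ^ 2 :=
      pow_le_pow_left₀ (mul_nonneg hS0.le (by linarith)) hlin 2
    have h2 : V * S - (m * S + u * (sy ^ 2 - sx ^ 2)) ^ 2
        = 4 * (u * sx * sy) ^ 2 * (1 - ρ ^ 2) := by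
      rw [hV, hS]; ring
    have h3 : 0 ≤ 4 * (u * sx * sy) ^ 2 * (1 - ρ ^ 2) :=
      mul_nonneg (by positivity) (by nlinarith)
    linarith
  have hV' : S * (m - |u|) ^ 2 ≤ V := by
    refine le_of_mul_le_mul_right ?_ hS0
    linarith
  refine Real.le_sqrt_of_sq_le ?_
  calc (4 * c * (m - |u|)) ^ 2 = 2 * (8 * c ^ 2) * (m - |u|) ^ 2 := by ring
    _ = 2 * π * (S * (m - |u|) ^ 2) := by rw [hcS]; ring
    _ ≤ 2 * π * V := by gcongr

lemma quadratic_gap {c k v : ℝ} (hk : 0 ≤ k) (hv : 0 ≤ v)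
    (hc : 0 < c) (h : v ^ 2 + k ^ 2 < c ^ 2) :
    (c ^ 2 - k ^ 2 - v ^ 2) * (c + k) < 2 * c * (c - k) * (c + k - v) := by
  have hkc : k < c := by nlinarith
  have hvc : v < c := by nlinarith
  have key : 0 < (c + k) * ((c + k) * v ^ 2 - 2 * c * (c - k) * v + (c - k) ^ 2 * (c + k)) := by
    have hexp : (c + k) * ((c + k) * v ^ 2 - 2 * c * (c - k) * v + (c - k) ^ 2 * (c + k))
        = ((c + k) * v - c * (c - k)) ^ 2 + (c - k) ^ 2 * (k * (2 * c + k)) := by ring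
    rw [hexp]
    rcases hk.eq_or_lt with rfl | hk
    · have : 0 < (c * (c - v)) ^ 2 := by
        have : 0 < c - v := by linarith
        positivity
      nlinarith
    · have : 0 < c - k := by linarith
      positivity
  nlinarith [pos_of_mul_pos_right key (by linarith : 0 ≤ c + k)]

lemma variance_pos {sx sy ρ α β : ℝ} (hsx : 0 < sx) (hsy : 0 < sy) (hρ : ρ ^ 2 < 1)
    (h : ¬(α = 0 ∧ β = 0)) :
    0 < sx ^ 2 * α ^ 2 + 2 * ρ * sx * sy * α * β + sy ^ 2 * β ^ 2 := by
  have hexp : sx ^ 2 * α ^ 2 + 2 * ρ * sx * sy * α * β + sy ^ 2 * β ^ 2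
      = (sx * α + ρ * sy * β) ^ 2 + (1 - ρ ^ 2) * (sy * β) ^ 2 := by ring
  have hρ' : 0 < 1 - ρ ^ 2 := by linarith
  rw [hexp]
  by_cases hβ : β = 0
  · have hα : α ≠ 0 := fun hα => h ⟨hα, hβ⟩
    subst hβ
    simp only [mul_zero, add_zero]
    positivity
  · positivity

theorem positive_inside_circle (sx sy ρ : ℝ) (hsx : 0 < sx) (hsy : 0 < sy)
    (hρ : ρ ∈ Set.Ioo (0 : ℝ) 1) (hσ : sx < sy) (a : ℝ × ℝ)
    (ha : a.1 ^ 2 + a.2 ^ 2 < 2 * (cstar sx sy ρ) ^ 2) :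
    0 < K sx sy ρ a ((cstar sx sy ρ, cstar sx sy ρ) : ℝ × ℝ) := by
  obtain ⟨hρ₀, hρ₁⟩ := hρ
  have hρ2 : ρ ^ 2 ≤ 1 := by nlinarith
  have hc : 0 < cstar sx sy ρ := by rw [cstar]; positivity
  have hcS : 8 * cstar sx sy ρ ^ 2 = π * (sx ^ 2 + 2 * ρ * sx * sy + sy ^ 2) := by
    rw [cstar, div_pow, Real.sq_sqrt (by positivity)]
    ring
  generalize cstar sx sy ρ = c at *
  obtain ⟨x, y⟩ := a
  simp only at ha
  have hne : ((x, y) : ℝ × ℝ) ≠ (c, c) := by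
    rintro h
    obtain ⟨rfl, rfl⟩ := Prod.mk.inj h
    linarith
  rw [K, if_neg hne]
  simp only [← measureReal_def]
  obtain ⟨m, hm⟩ : ∃ m, m = c - (x + y) / 2 := ⟨_, rfl⟩
  obtain ⟨u, hu⟩ : ∃ u, u = (x - y) / 2 := ⟨_, rfl⟩
  have hcirc : |u| ^ 2 + ((x + y) / 2) ^ 2 < c ^ 2 := by
    rw [sq_abs, hu]; nlinarith
  set P₁ := (binormal sx sy ρ).real (closerTo (x, y) (c, c)) with hP₁
  set P₂ := (binormal sx sy ρ).real (closerTo (c, c) (x, y)) with hP₂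
  have hP₂0 : 0 ≤ P₂ := measureReal_nonneg
  rcases lt_or_ge 0 (x + y) with hpos | hneg
  · have hP₁pos : 0 < P₁ := by
      have hvar : 0 < sx ^ 2 * (x - c) ^ 2 + 2 * ρ * sx * sy * (x - c) * (y - c)
          + sy ^ 2 * (y - c) ^ 2 := variance_pos hsx hsy (by nlinarith) (by
        by_contra! h
        exact hne (Prod.ext (by linarith [h.1]) (by linarith [h.2])))
      rw [hP₁, binormal_real_closerTo hρ2]
      calc (0 : ℝ) < 1 / 2 := by norm_num
        _ = _ := (gaussianReal_real_Ioi_zero (Real.toNNReal_pos.2 hvar).ne').symm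
        _ ≤ _ := measureReal_mono (Set.Ioi_subset_Ioi (by dsimp only; linarith))
    have h₁ : 0 < (x + y) * P₁ := mul_pos hpos hP₁pos
    have h₂ : 0 ≤ (c + c) * P₂ := by positivity
    exact add_pos_of_pos_of_nonneg h₁ h₂
  · have hum : |u| < m := by nlinarith [abs_nonneg u]
    have hsqrt := sqrt_lower_bound hsx hsy hρ₀.le hρ₁.le hcS hum
    have hgap := quadratic_gap (k := -(x + y) / 2) (v := |u|) (by linarith) (abs_nonneg u) hc
      (by nlinarith)
    have hL : 0 < 4 * c * (m - |u|) := mul_pos (by linarith) (by linarith)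
    have hx : m - u = c - x := by rw [hm, hu]; ring
    have hy : m + u = c - y := by rw [hm, hu]; ring
    rw [hx, hy] at hsqrt
    set V := sx ^ 2 * (c - x) ^ 2 + 2 * ρ * sx * sy * (c - x) * (c - y) + sy ^ 2 * (c - y) ^ 2
      with hV
    have hV0 : 0 < V := by
      have := Real.sqrt_pos.1 (hL.trans_le hsqrt)
      exact pos_of_mul_pos_right this (by positivity)
    have hh : (c ^ 2 + c ^ 2 - x ^ 2 - y ^ 2) / 2 = c ^ 2 - (-(x + y) / 2) ^ 2 - |u| ^ 2 := by
      rw [sq_abs, hu]; ring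
    set h := (c ^ 2 + c ^ 2 - x ^ 2 - y ^ 2) / 2 with h_def
    have h0 : 0 ≤ h := by linarith
    have hbound : 1 / 2 - h / (4 * c * (m - |u|)) ≤ P₂ := by
      rw [hP₂, binormal_real_closerTo hρ2]
      refine le_trans ?_ (half_sub_le_gaussianReal_real_Ioi (Real.toNNReal_pos.2 hV0).ne' h0)
      rw [Real.coe_toNNReal _ hV0.le]
      gcongr
    have hsum : P₁ ≤ 1 - P₂ := by
      have hdisj : Disjoint (closerTo (x, y) (c, c)) (closerTo (c, c) (x, y)) :=
        Set.disjoint_left.2 fun p h₁ h₂ => by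
          simp only [closerTo, Set.mem_ofPred_eq] at h₁ h₂
          exact lt_asymm h₁ h₂
      have hmeas : MeasurableSet (closerTo (c, c) (x, y)) := by
        rw [closerTo_eq_preimage_Ioi]
        exact (by fun_prop : Measurable _) measurableSet_Ioi
      have hunion := measureReal_union (μ := binormal sx sy ρ) hdisj hmeas
      have hle_one := measureReal_le_one (μ := binormal sx sy ρ)
        (s := closerTo (x, y) (c, c) ∪ closerTo (c, c) (x, y))
      linarith
    have hmain : -(x + y) < (2 * c - (x + y)) * (1 / 2 - h / (4 * c * (m - |u|))) := by
      rw [← sub_pos]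
      have hmu : c + -(x + y) / 2 - |u| = m - |u| := by rw [hm]; ring
      rw [← hh, hmu] at hgap
      have hrw : (2 * c - (x + y)) * (1 / 2 - h / (4 * c * (m - |u|))) - -(x + y)
          = (2 * c * (c - -(x + y) / 2) * (m - |u|) - h * (c + -(x + y) / 2)) * 2
            / (4 * c * (m - |u|)) := by
        have : m - |u| ≠ 0 := by linarith
        field_simp
        ring
      rw [hrw]
      exact div_pos (by linarith) hL
    have h₁ := mul_le_mul_of_nonneg_left hbound (by linarith : 0 ≤ 2 * c - (x + y))
    have h₂ := mul_le_mul_of_nonpos_left hsum hneg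
    change 0 < (x + y) * P₁ + (c + c) * P₂
    linarith
end

section
/- Assume ρ ∈ (0,1). Then (a*, b*) is the unique global pure equilibrium pair: K(a*, b*) = 0; K(a, b*) > 0 for every a ∈ ℝ² with a ≠ a*; and K(a*, b) < 0 for every b ∈ ℝ² with b ≠ b*. In particular K(a*, b) ≤ 0 ≤ K(a, b*) for all a, b ∈ ℝ². -/
open MeasureTheory ProbabilityTheory Real

/-- The upper tail probability of the standard normal law. -/
noncomputable def normalTail (x : ℝ) : ℝ := (gaussianReal 0 1).real (Set.Ioi x)

lemma measureReal_Iio_eq_one_sub_normalTail (x : ℝ) :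
    (gaussianReal 0 1).real (Set.Iio x) = 1 - normalTail x := by
  have := nullSingletonClass_gaussianReal (μ := 0) (v := 1) one_ne_zero
  rw [normalTail, ← probReal_compl_eq_one_sub measurableSet_Ioi, Set.compl_Ioi]
  exact measureReal_congr Iio_ae_eq_Iic

lemma normalTail_neg (x : ℝ) : normalTail (-x) = 1 - normalTail x := by
  rw [← measureReal_Iio_eq_one_sub_normalTail, normalTail]
  have h : (gaussianReal 0 1).map (fun y ↦ -y) = gaussianReal 0 1 := by
    simpa using gaussianReal_map_neg (μ := 0) (v := 1)
  conv_lhs => rw [← h]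
  rw [map_measureReal_apply measurable_neg measurableSet_Ioi]
  congr 1
  ext y
  simp

lemma normalTail_zero : normalTail 0 = 1 / 2 := by
  have := normalTail_neg 0
  rw [neg_zero] at this
  linarith

lemma normalTail_nonneg (x : ℝ) : 0 ≤ normalTail x := measureReal_nonneg

lemma normalTail_lt_one (x : ℝ) : normalTail x < 1 := by
  have h : 0 < (gaussianReal 0 1).real (Set.Iio x) := by
    refine measureReal_nonneg.lt_of_ne' fun h0 ↦ ?_
    rw [measureReal_eq_zero_iff] at h0
    have := gaussianReal_absolutelyContinuous' 0 (v := 1) one_ne_zero h0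
    simp at this
  linarith [measureReal_Iio_eq_one_sub_normalTail x]

lemma normalTail_eq_integral (x : ℝ) :
    normalTail x = ∫ t in Set.Ioi x, gaussianPDFReal 0 1 t := by
  rw [normalTail, measureReal_def, gaussianReal_apply_eq_integral 0 one_ne_zero,
    ENNReal.toReal_ofReal]
  exact integral_nonneg fun t ↦ gaussianPDFReal_nonneg _ _ _

lemma continuous_gaussianPDFReal (m : ℝ) (v : NNReal) : Continuous (gaussianPDFReal m v) := by
  rw [gaussianPDFReal_def]
  fun_prop

lemma hasDerivAt_normalTail (x : ℝ) : HasDerivAt normalTail (-gaussianPDFReal 0 1 x) x := by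
  have hint := integrable_gaussianPDFReal 0 1
  have heq : normalTail = fun y ↦ normalTail 0 - ∫ t in (0 : ℝ)..y, gaussianPDFReal 0 1 t := by
    funext y
    rw [← intervalIntegral.integral_Ioi_sub_Ioi' hint.integrableOn hint.integrableOn,
      normalTail_eq_integral, normalTail_eq_integral]
    ring
  rw [heq]
  exact ((continuous_gaussianPDFReal 0 1).integral_hasStrictDerivAt 0 x).hasDerivAt.const_sub _

lemma tendsto_normalTail_atTop : Filter.Tendsto normalTail Filter.atTop (nhds 0) := by
  have h : normalTail = fun x ↦ 1 - cdf (gaussianReal 0 1) x := by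
    funext x
    rw [cdf_eq_real, ← Set.compl_Ioi, probReal_compl_eq_one_sub measurableSet_Ioi, normalTail]
    ring
  rw [h]
  simpa using (tendsto_cdf_atTop (gaussianReal 0 1)).const_sub 1

lemma hasDerivAt_stdGaussianPDFReal (x : ℝ) :
    HasDerivAt (gaussianPDFReal 0 1) (-x * gaussianPDFReal 0 1 x) x := by
  have h : HasDerivAt (fun y : ℝ ↦ -(y - 0) ^ 2 / (2 * ((1 : NNReal) : ℝ))) (-x) x := by
    have := (((hasDerivAt_id x).sub_const 0).pow 2).neg.div_const (2 * ((1 : NNReal) : ℝ))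
    refine this.congr_deriv ?_
    simp
    ring
  rw [gaussianPDFReal_def]
  refine (h.exp.const_mul _).congr_deriv ?_
  dsimp only
  ring

lemma gaussianPDFReal_le_at_mean (m : ℝ) (v : NNReal) (x : ℝ) :
    gaussianPDFReal m v x ≤ gaussianPDFReal m v m := by
  simp only [gaussianPDFReal]
  refine mul_le_mul_of_nonneg_left (exp_le_exp.2 ?_) (by positivity)
  gcongr ?_ / _
  rw [sub_self]
  nlinarith [sq_nonneg (x - m)]

lemma tendsto_stdGaussianPDFReal_atTop :
    Filter.Tendsto (gaussianPDFReal 0 1) Filter.atTop (nhds 0) := by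
  have h : Filter.Tendsto (fun y : ℝ ↦ -(y - 0) ^ 2 / (2 * ((1 : NNReal) : ℝ)))
      Filter.atTop Filter.atBot := by
    have h2 := (Filter.tendsto_pow_atTop (α := ℝ) two_ne_zero).const_mul_atTop_of_neg
      (show (-1 / 2 : ℝ) < 0 by norm_num)
    refine h2.congr fun y ↦ ?_
    simp
    ring
  rw [gaussianPDFReal_def]
  simpa using (Real.tendsto_exp_atBot.comp h).const_mul (√(2 * π * ((1 : NNReal) : ℝ)))⁻¹

/-- A concavity bound: the tail lies below its tangent at the origin on the negative half line. -/
lemma normalTail_le_linear {x : ℝ} (hx : x ≤ 0) :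
    normalTail x ≤ 1 / 2 - gaussianPDFReal 0 1 0 * x := by
  have hmono : Monotone fun y ↦ normalTail y + gaussianPDFReal 0 1 0 * y := by
    have hd : ∀ y, HasDerivAt (fun y ↦ normalTail y + gaussianPDFReal 0 1 0 * y)
        (-gaussianPDFReal 0 1 y + gaussianPDFReal 0 1 0 * 1) y := fun y ↦
      (hasDerivAt_normalTail y).add ((hasDerivAt_id y).const_mul _)
    refine monotone_of_deriv_nonneg (fun y ↦ (hd y).differentiableAt) fun y ↦ ?_
    rw [(hd y).deriv]
    linarith [gaussianPDFReal_le_at_mean 0 1 y]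
  have := hmono hx
  simp only [normalTail_zero] at this
  linarith

/-- The standard normal hazard rate is at least its value at the origin on the positive
half line. -/
lemma mul_normalTail_le_gaussianPDFReal {x : ℝ} (hx : 0 ≤ x) :
    2 * gaussianPDFReal 0 1 0 * normalTail x ≤ gaussianPDFReal 0 1 x := by
  set k := 2 * gaussianPDFReal 0 1 0 with hk
  have hkpos : 0 < k := by
    have := gaussianPDFReal_pos 0 1 0 one_ne_zero
    positivity
  let G : ℝ → ℝ := fun y ↦ gaussianPDFReal 0 1 y - k * normalTail y
  have hd : ∀ y, HasDerivAt G ((k - y) * gaussianPDFReal 0 1 y) y := fun y ↦ by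
    refine ((hasDerivAt_stdGaussianPDFReal y).sub
      ((hasDerivAt_normalTail y).const_mul k)).congr_deriv ?_
    ring
  have hdiff : Differentiable ℝ G := fun y ↦ (hd y).differentiableAt
  have hG0 : G 0 = 0 := by
    simp only [G, normalTail_zero, hk]
    ring
  suffices h : 0 ≤ G x by
    simp only [G] at h
    linarith
  rcases le_total x k with hxk | hxk
  · have hmono : MonotoneOn G (Set.Icc 0 k) := by
      refine monotoneOn_of_deriv_nonneg (convex_Icc 0 k) hdiff.continuous.continuousOn
        hdiff.differentiableOn fun y hy ↦ ?_
      rw [interior_Icc] at hy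
      rw [(hd y).deriv]
      exact mul_nonneg (by linarith [hy.2]) (gaussianPDFReal_nonneg _ _ _)
    rw [← hG0]
    exact hmono ⟨le_rfl, hkpos.le⟩ ⟨hx, hxk⟩ hx
  · have hanti : AntitoneOn G (Set.Ici k) := by
      refine antitoneOn_of_deriv_nonpos (convex_Ici k) hdiff.continuous.continuousOn
        hdiff.differentiableOn fun y hy ↦ ?_
      rw [interior_Ici] at hy
      rw [(hd y).deriv]
      exact mul_nonpos_of_nonpos_of_nonneg (by linarith [Set.mem_Ioi.1 hy])
        (gaussianPDFReal_nonneg _ _ _)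
    have hlim : Filter.Tendsto G Filter.atTop (nhds 0) := by
      simpa using tendsto_stdGaussianPDFReal_atTop.sub (tendsto_normalTail_atTop.const_mul k)
    refine le_of_tendsto hlim ?_
    filter_upwards [Filter.eventually_ge_atTop x] with y hy
    exact hanti hxk (hxk.trans hy) hy

/-- A log-concavity bound for the standard normal tail. -/
lemma normalTail_le_exp {x : ℝ} (hx : 0 ≤ x) :
    normalTail x ≤ exp (-(2 * gaussianPDFReal 0 1 0 * x)) / 2 := by
  set k := 2 * gaussianPDFReal 0 1 0 with hk
  have hd : ∀ y, HasDerivAt (fun y ↦ normalTail y * exp (k * y))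
      (-gaussianPDFReal 0 1 y * exp (k * y) + normalTail y * (exp (k * y) * (k * 1))) y :=
    fun y ↦ (hasDerivAt_normalTail y).mul ((hasDerivAt_id y).const_mul k).exp
  have hdiff : Differentiable ℝ fun y ↦ normalTail y * exp (k * y) :=
    fun y ↦ (hd y).differentiableAt
  have hanti : AntitoneOn (fun y ↦ normalTail y * exp (k * y)) (Set.Ici 0) := by
    refine antitoneOn_of_deriv_nonpos (convex_Ici 0) hdiff.continuous.continuousOn
      hdiff.differentiableOn fun y hy ↦ ?_
    rw [interior_Ici] at hy
    rw [(hd y).deriv]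
    have := mul_normalTail_le_gaussianPDFReal (le_of_lt (Set.mem_Ioi.1 hy))
    nlinarith [exp_pos (k * y)]
  have h := hanti (Set.mem_Ici.2 le_rfl) (Set.mem_Ici.2 hx) hx
  simp only [normalTail_zero, mul_zero, exp_zero, mul_one] at h
  rw [exp_neg, ← one_div, div_div, le_div_iff₀ (by positivity)]
  linarith

/-- The scalar inequality behind the equilibrium: here `T` and `V` are the normalized coordinates
of the offer difference along and across the diagonal, and `r` is the normalized standard deviation
of the projection on that difference. -/
lemma mul_normalTail_lt_half {T V r x : ℝ} (hT : 1 / 2 < T) (hr : 0 < r) (hr_le : r ≤ T + |V|)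
    (hle_r : T - |V| ≤ r) (hx : 2 * gaussianPDFReal 0 1 0 * x * r = T ^ 2 + V ^ 2 - T)
    (hne : T ≠ 1 ∨ V ≠ 0) : T * normalTail x < 1 / 2 := by
  have hk : 0 < 2 * gaussianPDFReal 0 1 0 := by
    have := gaussianPDFReal_pos 0 1 0 one_ne_zero
    positivity
  set k := 2 * gaussianPDFReal 0 1 0 with hkdef
  have hV : 0 ≤ |V| := abs_nonneg V
  have hV2 : V ^ 2 = |V| ^ 2 := (sq_abs V).symm
  set W := |V|
  have hxpos : 0 ≤ T ^ 2 + V ^ 2 - T → 0 ≤ x := fun h ↦ by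
    by_contra! hneg
    have : k * x * r < 0 := mul_neg_of_neg_of_pos (mul_neg_of_pos_of_neg hk hneg) hr
    linarith
  rcases lt_trichotomy T 1 with hT1 | rfl | hT1
  · rcases le_or_gt 0 (T ^ 2 + V ^ 2 - T) with hN | hN
    · have h1 := normalTail_le_exp (hxpos hN)
      have h2 : exp (-(k * x)) ≤ 1 :=
        exp_le_one_iff.2 (neg_nonpos.2 (mul_nonneg hk.le (hxpos hN)))
      nlinarith
    · have hxneg : x ≤ 0 := by
        by_contra! hpos
        have : 0 < k * x * r := by positivity
        linarith
      have h1 := normalTail_le_linear hxneg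
      have h2 : normalTail x ≤ (1 - k * x) / 2 := by
        rw [hkdef]
        linarith
      have hmain : 0 < T * W ^ 2 - (1 - T) * W + T * (1 - T) ^ 2 := by
        have hs : 0 < (4 * T ^ 2 - 1) * (1 - T) ^ 2 :=
          mul_pos (by nlinarith) (pow_pos (by linarith) 2)
        nlinarith [sq_nonneg (2 * T * W - (1 - T))]
      have h3 : T * (-(k * x * r)) < (1 - T) * r := by
        rw [hx, hV2]
        nlinarith [mul_le_mul_of_nonneg_left hle_r (sub_nonneg.2 hT1.le)]
      have h4 : T * (-(k * x)) < 1 - T := by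
        refine lt_of_mul_lt_mul_right ?_ hr.le
        linarith
      nlinarith
  · have hV0 : 0 < V ^ 2 := by
      have : V ≠ 0 := by tauto
      positivity
    have hx0 := hxpos (by linarith)
    have hx1 : 0 < k * x := by
      refine pos_of_mul_pos_left ?_ hr.le
      linarith
    have h2 : exp (-(k * x)) < 1 := by simpa using hx1
    linarith [normalTail_le_exp hx0]
  · have hT0 : 0 < T := by linarith
    have hx0 := hxpos (by nlinarith [sq_nonneg V])
    have hlog0 : 0 ≤ log T := log_nonneg hT1.le
    have hlog : log T ≤ (T - T⁻¹) / 2 := by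
      rw [← sinh_log hT0]
      exact self_le_sinh_iff.2 hlog0
    have hlog' : 2 * T * log T ≤ T ^ 2 - 1 := by
      have h := mul_le_mul_of_nonneg_left hlog (show 0 ≤ 2 * T by linarith)
      have h' : 2 * T * ((T - T⁻¹) / 2) = T ^ 2 - 1 := by field_simp
      linarith
    set l := log T
    have hdisc : l ^ 2 + 4 * T * l < 4 * T ^ 2 - 4 * T := by
      have h1 : (2 * T * l) ^ 2 ≤ (T ^ 2 - 1) ^ 2 := by
        have : 0 ≤ 2 * T * l := by positivity
        gcongr
      have h2 : 0 < 8 * T ^ 2 - (T + 1) ^ 2 := by nlinarith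
      have h3 : 0 < (T - 1) ^ 2 * (8 * T ^ 2 - (T + 1) ^ 2) :=
        mul_pos (pow_pos (by linarith) 2) h2
      have h4 : 4 * T ^ 2 * (l ^ 2 + 4 * T * l) < 4 * T ^ 2 * (4 * T ^ 2 - 4 * T) := by
        nlinarith [mul_le_mul_of_nonneg_left hlog' (show 0 ≤ 8 * T ^ 2 by positivity)]
      exact lt_of_mul_lt_mul_left h4 (by positivity)
    have h5 : l * r < k * x * r := by
      rw [hx, hV2]
      nlinarith [mul_le_mul_of_nonneg_left hr_le hlog0, sq_nonneg (2 * W - l)]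
    have h6 : l < k * x := lt_of_mul_lt_mul_right h5 hr.le
    have h7 : exp (-(k * x)) < T⁻¹ := by
      rw [← exp_log hT0, ← exp_neg]
      exact exp_lt_exp.2 (neg_lt_neg h6)
    calc T * normalTail x ≤ T * (exp (-(k * x)) / 2) := by
          gcongr
          exact normalTail_le_exp hx0
      _ < T * (T⁻¹ / 2) := by gcongr
      _ = 1 / 2 := by field_simp

/-- A linear combination of two independent standard normal variables is distributed as a multiple
of one of them. -/
lemma map_linear_prod_gaussianReal (α β : ℝ) :
    ((gaussianReal 0 1).prod (gaussianReal 0 1)).map (fun z : ℝ × ℝ ↦ α * z.1 + β * z.2)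
      = (gaussianReal 0 1).map (√(α ^ 2 + β ^ 2) * ·) := by
  have h : (fun z : ℝ × ℝ ↦ α * z.1 + β * z.2)
      = (fun z : ℝ × ℝ ↦ z.1 + z.2) ∘ Prod.map (α * ·) (β * ·) := rfl
  rw [h, ← Measure.map_map (by fun_prop) (by fun_prop),
    ← Measure.map_prod_map _ _ (by fun_prop) (by fun_prop)]
  change Measure.conv _ _ = _
  rw [gaussianReal_map_const_mul, gaussianReal_map_const_mul, gaussianReal_map_const_mul,
    gaussianReal_conv_gaussianReal]
  congr 1
  · simp
  · ext
    simp [sq_sqrt (add_nonneg (sq_nonneg α) (sq_nonneg β))]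

/-- The standard deviation under `binormal sx sy ρ` of the projection on `u`. -/
noncomputable def projStd (sx sy ρ : ℝ) (u : ℝ × ℝ) : ℝ :=
  √(sx ^ 2 * u.1 ^ 2 + 2 * ρ * sx * sy * u.1 * u.2 + sy ^ 2 * u.2 ^ 2)

lemma projVar_pos {sx sy ρ : ℝ} (hsx : 0 < sx) (hsy : 0 < sy) (hρ : ρ ∈ Set.Ioo (0 : ℝ) 1)
    {u : ℝ × ℝ} (hu : u ≠ 0) :
    0 < sx ^ 2 * u.1 ^ 2 + 2 * ρ * sx * sy * u.1 * u.2 + sy ^ 2 * u.2 ^ 2 := by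
  have h1 : 0 < 1 - ρ ^ 2 := by nlinarith [hρ.1, hρ.2]
  have h : sx ^ 2 * u.1 ^ 2 + 2 * ρ * sx * sy * u.1 * u.2 + sy ^ 2 * u.2 ^ 2
      = (sx * u.1 + ρ * sy * u.2) ^ 2 + (1 - ρ ^ 2) * sy ^ 2 * u.2 ^ 2 := by ring
  rw [h]
  by_cases h2 : u.2 = 0
  · have h3 : u.1 ≠ 0 := fun h3 ↦ hu (Prod.ext h3 h2)
    rw [h2]
    have : 0 < (sx * u.1) ^ 2 := by positivity
    linarith
  · positivity

lemma map_proj_binormal {sx sy ρ : ℝ} (hρ : ρ ∈ Set.Ioo (0 : ℝ) 1) (u : ℝ × ℝ) :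
    (binormal sx sy ρ).map (fun p : ℝ × ℝ ↦ p.1 * u.1 + p.2 * u.2)
      = (gaussianReal 0 1).map (projStd sx sy ρ u * ·) := by
  have h1 : 0 ≤ 1 - ρ ^ 2 := by nlinarith [hρ.1, hρ.2]
  rw [binormal, Measure.map_map (by fun_prop) (by fun_prop)]
  convert map_linear_prod_gaussianReal (sx * u.1 + ρ * sy * u.2) (√(1 - ρ ^ 2) * sy * u.2) using 2
  · funext z
    simp only [Function.comp_apply]
    ring
  · funext y
    rw [projStd]
    congr 2
    rw [mul_pow, mul_pow, sq_sqrt h1]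
    ring

/-- The payoff of two distinct offers in terms of the standard normal tail. -/
lemma K_eq_normalTail {sx sy ρ : ℝ} (hsx : 0 < sx) (hsy : 0 < sy) (hρ : ρ ∈ Set.Ioo (0 : ℝ) 1)
    {a b : ℝ × ℝ} (hab : a ≠ b) :
    K sx sy ρ a b
      = (a.1 + a.2)
          * (1 - normalTail
            ((b.1 ^ 2 + b.2 ^ 2 - a.1 ^ 2 - a.2 ^ 2) / (2 * projStd sx sy ρ (b - a))))
        + (b.1 + b.2)
          * normalTail
            ((b.1 ^ 2 + b.2 ^ 2 - a.1 ^ 2 - a.2 ^ 2) / (2 * projStd sx sy ρ (b - a))) := by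
  have hs : 0 < projStd sx sy ρ (b - a) :=
    sqrt_pos.2 (projVar_pos hsx hsy hρ (sub_ne_zero.2 hab.symm))
  have hmap := map_proj_binormal (sx := sx) (sy := sy) hρ (b - a)
  set s := projStd sx sy ρ (b - a)
  set m := b.1 ^ 2 + b.2 ^ 2 - a.1 ^ 2 - a.2 ^ 2 with hm
  have hL : Measurable fun p : ℝ × ℝ ↦ p.1 * (b - a).1 + p.2 * (b - a).2 := by fun_prop
  have hM : Measurable (s * · : ℝ → ℝ) := by fun_prop
  have hb : (binormal sx sy ρ).real (closerTo b a) = normalTail (m / (2 * s)) := by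
    have hset : closerTo b a
        = (fun p : ℝ × ℝ ↦ p.1 * (b - a).1 + p.2 * (b - a).2) ⁻¹' Set.Ioi (m / 2) := by
      ext p
      simp only [closerTo, Set.mem_ofPred_eq, Set.mem_preimage, Set.mem_Ioi, Prod.fst_sub,
        Prod.snd_sub, hm]
      constructor <;> intro h <;> linarith
    rw [hset, ← map_measureReal_apply hL measurableSet_Ioi, hmap,
      map_measureReal_apply hM measurableSet_Ioi, normalTail]
    congr 1
    ext y
    simp only [Set.mem_preimage, Set.mem_Ioi]
    rw [← div_div, div_lt_iff₀' hs]
  have ha : (binormal sx sy ρ).real (closerTo a b) = 1 - normalTail (m / (2 * s)) := by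
    have hset : closerTo a b
        = (fun p : ℝ × ℝ ↦ p.1 * (b - a).1 + p.2 * (b - a).2) ⁻¹' Set.Iio (m / 2) := by
      ext p
      simp only [closerTo, Set.mem_ofPred_eq, Set.mem_preimage, Set.mem_Iio, Prod.fst_sub,
        Prod.snd_sub, hm]
      constructor <;> intro h <;> linarith
    rw [hset, ← map_measureReal_apply hL measurableSet_Iio, hmap,
      map_measureReal_apply hM measurableSet_Iio, ← measureReal_Iio_eq_one_sub_normalTail]
    congr 1
    ext y
    simp only [Set.mem_preimage, Set.mem_Iio]
    rw [← div_div, lt_div_iff₀' hs]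
  rw [K, if_neg hab, ← measureReal_def, ← measureReal_def, ha, hb]

/-- Negating and exchanging the two offers reverses the payoff. -/
lemma K_neg_neg {sx sy ρ : ℝ} (hsx : 0 < sx) (hsy : 0 < sy) (hρ : ρ ∈ Set.Ioo (0 : ℝ) 1)
    (a b : ℝ × ℝ) : K sx sy ρ (-b) (-a) = -K sx sy ρ a b := by
  by_cases hab : a = b
  · subst hab
    simp [K]
    ring
  · rw [K_eq_normalTail hsx hsy hρ hab,
      K_eq_normalTail hsx hsy hρ (fun h ↦ hab (neg_injective h).symm)]
    have h1 : -a - -b = b - a := by abel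
    have h2 : ((-a).1 ^ 2 + (-a).2 ^ 2 - (-b).1 ^ 2 - (-b).2 ^ 2) / (2 * projStd sx sy ρ (b - a))
        = -((b.1 ^ 2 + b.2 ^ 2 - a.1 ^ 2 - a.2 ^ 2) / (2 * projStd sx sy ρ (b - a))) := by
      simp only [Prod.fst_neg, Prod.snd_neg]
      ring
    rw [h1, h2, normalTail_neg]
    simp only [Prod.fst_neg, Prod.snd_neg]
    ring

lemma cstar_pos {sx sy ρ : ℝ} (hsx : 0 < sx) (hsy : 0 < sy) (hρ : 0 < ρ) :
    0 < cstar sx sy ρ := by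
  rw [cstar]
  positivity

/-- The optimal offer scales the density at the origin to the standard deviation of the sum of the
coordinates. -/
lemma four_mul_gaussianPDFReal_mul_cstar (sx sy ρ : ℝ) :
    2 * gaussianPDFReal 0 1 0 * (2 * cstar sx sy ρ) = √(sx ^ 2 + 2 * ρ * sx * sy + sy ^ 2) := by
  have h : √(2 * π) ≠ 0 := by positivity
  rw [cstar, sqrt_mul (by positivity)]
  simp [gaussianPDFReal]
  field_simp
  ring

/-- Bounds on the normalized standard deviation of the projection on `(T + V, T - V)`. -/
lemma normalized_projStd_bounds {sx sy ρ T V r σ : ℝ} (hsx : 0 < sx) (hsy : 0 < sy)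
    (hρ : ρ ∈ Set.Ioo (0 : ℝ) 1) (hTpos : 0 < T) (hrpos : 0 < r) (hσpos : 0 < σ)
    (hσsq : σ ^ 2 = sx ^ 2 + 2 * ρ * sx * sy + sy ^ 2)
    (hrsq : σ ^ 2 * r ^ 2 = sx ^ 2 * (T + V) ^ 2
      + 2 * ρ * sx * sy * (T + V) * (T - V) + sy ^ 2 * (T - V) ^ 2) :
    r ≤ T + |V| ∧ T - |V| ≤ r := by
  have hρs : 0 < ρ * (sx * sy) := mul_pos hρ.1 (mul_pos hsx hsy)
  obtain ⟨A, hA⟩ : ∃ A, A = sx ^ 2 - sy ^ 2 := ⟨_, rfl⟩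
  have hA_le : |A| ≤ σ ^ 2 := by
    rw [abs_le, hσsq, hA]
    constructor <;> nlinarith
  have hAV : |A * V| ≤ σ ^ 2 * |V| := by
    rw [abs_mul]
    gcongr
  have hV2 : V ^ 2 = |V| ^ 2 := (sq_abs V).symm
  constructor
  · have h1 : σ ^ 2 * r ^ 2 ≤ σ ^ 2 * (T + |V|) ^ 2 := by
      have h2 : σ ^ 2 * r ^ 2 = σ ^ 2 * T ^ 2 + 2 * (A * V) * T
          + (σ ^ 2 - 4 * (ρ * (sx * sy))) * V ^ 2 := by
        rw [hrsq, hσsq, hA]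
        ring
      nlinarith [mul_le_mul_of_nonneg_right ((le_abs_self _).trans hAV) hTpos.le,
        mul_nonneg hρs.le (sq_nonneg V)]
    exact (sq_le_sq₀ hrpos.le (by positivity)).1 (le_of_mul_le_mul_left h1 (by positivity))
  · have h1 : (σ ^ 2 * T + A * V) ^ 2 ≤ (σ ^ 2 * r) ^ 2 := by
      have h2 : (σ ^ 2 * r) ^ 2 = (σ ^ 2 * T + A * V) ^ 2
          + 4 * sx ^ 2 * sy ^ 2 * (1 - ρ ^ 2) * V ^ 2 := by
        have : (σ ^ 2 * r) ^ 2 = σ ^ 2 * (σ ^ 2 * r ^ 2) := by ring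
        rw [this, hrsq, hσsq, hA]
        ring
      have h3 : 0 ≤ 1 - ρ ^ 2 := by nlinarith [hρ.1, hρ.2]
      have : 0 ≤ 4 * sx ^ 2 * sy ^ 2 * (1 - ρ ^ 2) * V ^ 2 := by positivity
      linarith
    have h2 : σ ^ 2 * T + A * V ≤ σ ^ 2 * r := le_of_sq_le_sq h1 (by positivity)
    refine le_of_mul_le_mul_left ?_ (show 0 < σ ^ 2 by positivity)
    linarith [neg_abs_le (A * V)]

/-- Against the offer `(-c, -c)` every offer other than `(c, c)` yields a negative payoff. -/
lemma K_neg_cstar_lt_zero {sx sy ρ : ℝ} (hsx : 0 < sx) (hsy : 0 < sy)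
    (hρ : ρ ∈ Set.Ioo (0 : ℝ) 1) {b : ℝ × ℝ} (hb : b ≠ (cstar sx sy ρ, cstar sx sy ρ)) :
    K sx sy ρ (-cstar sx sy ρ, -cstar sx sy ρ) b < 0 := by
  have hc := cstar_pos hsx hsy hρ.1
  have hkc := four_mul_gaussianPDFReal_mul_cstar sx sy ρ
  set c := cstar sx sy ρ
  by_cases hab : ((-c, -c) : ℝ × ℝ) = b
  · rw [K, if_pos hab]
    dsimp only
    linarith
  have hu : b - (-c, -c) ≠ 0 := sub_ne_zero.2 (Ne.symm hab)
  have hvar := projVar_pos hsx hsy hρ hu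
  rw [K_eq_normalTail hsx hsy hρ hab]
  set x := (b.1 ^ 2 + b.2 ^ 2 - ((-c, -c) : ℝ × ℝ).1 ^ 2 - ((-c, -c) : ℝ × ℝ).2 ^ 2)
    / (2 * projStd sx sy ρ (b - (-c, -c))) with hx
  suffices h : (b.1 + b.2 + 2 * c) * normalTail x < 2 * c by
    dsimp only
    linarith
  obtain ⟨T, V, rfl⟩ : ∃ T V, b = (2 * c * (T + V) - c, 2 * c * (T - V) - c) := by
    refine ⟨(b.1 + b.2 + 2 * c) / (4 * c), (b.1 - b.2) / (4 * c), Prod.ext ?_ ?_⟩ <;>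
    · dsimp only
      field_simp
      ring
  have hsum : 2 * c * (T + V) - c + (2 * c * (T - V) - c) + 2 * c = 4 * c * T := by ring
  dsimp only
  rw [hsum]
  suffices h : T * normalTail x < 1 / 2 by nlinarith
  rcases le_or_gt T (1 / 2) with hT | hT
  · nlinarith [normalTail_lt_one x, normalTail_nonneg x]
  have hvs : 0 < sx ^ 2 + 2 * ρ * sx * sy + sy ^ 2 := by
    have := hρ.1
    positivity
  set σ := √(sx ^ 2 + 2 * ρ * sx * sy + sy ^ 2)
  have hσpos : 0 < σ := sqrt_pos.2 hvs
  have hσsq : σ ^ 2 = sx ^ 2 + 2 * ρ * sx * sy + sy ^ 2 := sq_sqrt hvs.le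
  set s := projStd sx sy ρ ((2 * c * (T + V) - c, 2 * c * (T - V) - c) - (-c, -c)) with hs
  have hspos : 0 < s := sqrt_pos.2 hvar
  have hssq : s ^ 2 = (2 * c) ^ 2 * (sx ^ 2 * (T + V) ^ 2
      + 2 * ρ * sx * sy * (T + V) * (T - V) + sy ^ 2 * (T - V) ^ 2) := by
    rw [hs, projStd, sq_sqrt hvar.le]
    simp only [Prod.mk_sub_mk]
    ring
  obtain ⟨r, hr⟩ : ∃ r, s = 2 * c * σ * r := ⟨s / (2 * c * σ), by field_simp⟩
  have hrpos : 0 < r := by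
    rw [hr] at hspos
    exact pos_of_mul_pos_right hspos (by positivity)
  have hrsq : σ ^ 2 * r ^ 2 = sx ^ 2 * (T + V) ^ 2
      + 2 * ρ * sx * sy * (T + V) * (T - V) + sy ^ 2 * (T - V) ^ 2 := by
    have h : (2 * c) ^ 2 * (σ ^ 2 * r ^ 2) = (2 * c) ^ 2 * (sx ^ 2 * (T + V) ^ 2
      + 2 * ρ * sx * sy * (T + V) * (T - V) + sy ^ 2 * (T - V) ^ 2) := by
      rw [← hssq, hr]
      ring
    exact mul_left_cancel₀ (by positivity) h
  obtain ⟨hle, hge⟩ := normalized_projStd_bounds hsx hsy hρ (by linarith) hrpos hσpos hσsq hrsq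
  refine mul_normalTail_lt_half hT hrpos hle hge ?_ ?_
  · have hxs : x * (2 * s) = 8 * c ^ 2 * (T ^ 2 + V ^ 2 - T) := by
      rw [hx, div_mul_cancel₀ _ (by positivity)]
      ring
    have h : 8 * c ^ 2 * (2 * gaussianPDFReal 0 1 0 * x * r)
        = 8 * c ^ 2 * (T ^ 2 + V ^ 2 - T) := by
      rw [← hxs, hr, ← hkc]
      ring
    exact mul_left_cancel₀ (by positivity) h
  · by_contra! hcon
    obtain ⟨rfl, rfl⟩ := hcon
    exact hb (Prod.ext (by ring) (by ring))

theorem unique_global_equilibrium (sx sy ρ : ℝ) (hsx : 0 < sx) (hsy : 0 < sy)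
    (hρ : ρ ∈ Set.Ioo (0 : ℝ) 1) :
    let c := cstar sx sy ρ
    let astar : ℝ × ℝ := (-c, -c)
    let bstar : ℝ × ℝ := (c, c)
    K sx sy ρ astar bstar = 0 ∧
      (∀ a : ℝ × ℝ, a ≠ astar → 0 < K sx sy ρ a bstar) ∧
      (∀ b : ℝ × ℝ, b ≠ bstar → K sx sy ρ astar b < 0) ∧
      (∀ a b : ℝ × ℝ, K sx sy ρ astar b ≤ 0 ∧ 0 ≤ K sx sy ρ a bstar) := by
  intro c astar bstar
  have hc : 0 < c := cstar_pos hsx hsy hρ.1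
  have hzero : K sx sy ρ astar bstar = 0 := by
    have hne : astar ≠ bstar := fun h ↦ by
      have := congrArg Prod.fst h
      simp only [astar, bstar] at this
      linarith
    rw [K_eq_normalTail hsx hsy hρ hne]
    simp only [astar, bstar]
    have h : (c ^ 2 + c ^ 2 - (-c) ^ 2 - (-c) ^ 2) = 0 := by ring
    rw [h, zero_div, normalTail_zero]
    ring
  have hmax : ∀ b : ℝ × ℝ, b ≠ bstar → K sx sy ρ astar b < 0 :=
    fun b hb ↦ K_neg_cstar_lt_zero hsx hsy hρ hb
  have hmin : ∀ a : ℝ × ℝ, a ≠ astar → 0 < K sx sy ρ a bstar := fun a ha ↦ by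
    have hneg : -bstar = astar := rfl
    have h := hmax (-a) fun h ↦ ha (by rw [← hneg, ← h, neg_neg])
    rw [← hneg, K_neg_neg hsx hsy hρ] at h
    linarith
  refine ⟨hzero, hmin, hmax, fun a b ↦ ⟨?_, ?_⟩⟩
  · rcases eq_or_ne b bstar with rfl | hb
    exacts [hzero.le, (hmax b hb).le]
  · rcases eq_or_ne a astar with rfl | ha
    exacts [hzero.ge, (hmin a ha).le]
end
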